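/- For all integers n ≥ 1 and k ≥ 2, the number of k-noncrossing partitions of {1,…,n+1} equals Σ_{i=0}^{n} C(n,i) · (the number of enhanced k-noncrossing partitions of {1,…,i}), where the number of enhanced k-noncrossing partitions of the empty set is 1. -/

import Mathlib

open Finset Polynomial

/-- `(i,j)` with `i < j` is an arc of the arc diagram of `P`: `i` and `j` lie in a common
block `B` and no element of `B` is strictly between them. -/
def IsArc {s : Finset ℕ} (P : Finpartition s) (i j : ℕ) : Prop :=
  i < j ∧ ∃ B ∈ P.parts, i ∈ B ∧ j ∈ B ∧ ∀ l ∈ B, ¬(i < l ∧ l < j)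

/-- `(i,j)` is an arc or a loop (`i = j` and `{i}` a singleton block) of the arc diagram. -/
def IsDiagArc {s : Finset ℕ} (P : Finpartition s) (i j : ℕ) : Prop :=
  IsArc P i j ∨ (i = j ∧ {i} ∈ P.parts)

/-- `P` has a `k`-crossing: arcs `(i₁,j₁),…,(i_k,j_k)` with `i₁<⋯<i_k<j₁<⋯<j_k`. -/
def HasKCrossing {s : Finset ℕ} (P : Finpartition s) (k : ℕ) : Prop :=
  ∃ f g : Fin k → ℕ,
    StrictMono f ∧ StrictMono g ∧ (∀ m, IsDiagArc P (f m) (g m)) ∧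
    ∀ a b : Fin k, f a < g b

/-- `P` has a weak `k`-crossing: arcs `(i₁,j₁),…,(i_k,j_k)` with
`i₁<⋯<i_k = j₁<⋯<j_k` (the largest left endpoint equals the smallest right endpoint). -/
def HasWeakKCrossing {s : Finset ℕ} (P : Finpartition s) (k : ℕ) : Prop :=
  ∃ f g : Fin k → ℕ,
    StrictMono f ∧ StrictMono g ∧ (∀ m, IsDiagArc P (f m) (g m)) ∧
    ∃ a b : Fin k, f a = g b ∧ (∀ c, f c ≤ f a) ∧ (∀ c, g b ≤ g c)

/-- `P` has an enhanced `k`-crossing: a `k`-crossing or a weak `k`-crossing. -/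
def HasEnhancedKCrossing {s : Finset ℕ} (P : Finpartition s) (k : ℕ) : Prop :=
  HasKCrossing P k ∨ HasWeakKCrossing P k

open scoped Classical in
/-- The generating polynomial `∑ t^{number of blocks}` over the partitions of `s`
satisfying the predicate `pr`. -/
noncomputable def partPoly (s : Finset ℕ) (pr : Finpartition s → Prop) : Polynomial ℤ :=
  ∑ P : Finpartition s, if pr P then (X : Polynomial ℤ) ^ P.parts.card else 0


/-- `IsArc` phrased through `Finpartition.part`. -/
theorem isArc_iff {s : Finset ℕ} (P : Finpartition s) {i j : ℕ} :
    IsArc P i j ↔ i < j ∧ i ∈ P.part j ∧ ∀ l ∈ P.part j, ¬(i < l ∧ l < j) := by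
  constructor
  · rintro ⟨hij, B, hB, hi, hj, h⟩
    rw [P.part_eq_of_mem hB hj]
    exact ⟨hij, hi, h⟩
  · rintro ⟨hij, hi, h⟩
    have hj : j ∈ s := P.part_nonempty.1 ⟨i, hi⟩
    exact ⟨hij, P.part j, P.part_mem.2 hj, hi, P.mem_part hj, h⟩

theorem IsArc.left_mem {s : Finset ℕ} {P : Finpartition s} {i j : ℕ} (h : IsArc P i j) :
    i ∈ s := by
  obtain ⟨-, B, hB, hi, -⟩ := h
  exact P.le hB hi

theorem IsArc.right_mem {s : Finset ℕ} {P : Finpartition s} {i j : ℕ} (h : IsArc P i j) :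
    j ∈ s := by
  obtain ⟨-, B, hB, -, hj, -⟩ := h
  exact P.le hB hj

theorem isArc_rightUnique {s : Finset ℕ} (P : Finpartition s) :
    Relator.RightUnique (IsArc P) := by
  rintro i j l ⟨hij, B, hB, hi, hj, h⟩ ⟨hil, C, hC, hi', hl, h'⟩
  obtain rfl := P.eq_of_mem_parts hB hC hi hi'
  have h1 := h l hl
  have h2 := h' j hj
  omega

theorem isArc_leftUnique {s : Finset ℕ} (P : Finpartition s) :
    Relator.LeftUnique (IsArc P) := by
  rintro i j l ⟨hij, B, hB, hi, hl, h⟩ ⟨hjl, C, hC, hj, hl', h'⟩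
  obtain rfl := P.eq_of_mem_parts hB hC hl hl'
  have h1 := h j hj
  have h2 := h' i hi
  omega

/-- In a block, every non-maximal element is the left end of an arc. -/
theorem exists_isArc_right {s : Finset ℕ} (P : Finpartition s) {B : Finset ℕ}
    (hB : B ∈ P.parts) {i j : ℕ} (hi : i ∈ B) (hj : j ∈ B) (hij : i < j) :
    ∃ l, IsArc P i l := by
  have hne : (B.filter (i < ·)).Nonempty := ⟨j, by simp [hj, hij]⟩
  have hm := Finset.min'_mem _ hne
  rw [Finset.mem_filter] at hm
  refine ⟨_, hm.2, B, hB, hi, hm.1, fun l hl h => ?_⟩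
  have := Finset.min'_le (B.filter (i < ·)) l (by simp [hl, h.1])
  omega

/-- In a block, every non-minimal element is the right end of an arc. -/
theorem exists_isArc_left {s : Finset ℕ} (P : Finpartition s) {B : Finset ℕ}
    (hB : B ∈ P.parts) {i j : ℕ} (hi : i ∈ B) (hj : j ∈ B) (hij : i < j) :
    ∃ l, IsArc P l j := by
  have hne : (B.filter (· < j)).Nonempty := ⟨i, by simp [hi, hij]⟩
  have hm := Finset.max'_mem _ hne
  rw [Finset.mem_filter] at hm
  refine ⟨_, hm.2, B, hB, hm.1, hj, fun l hl h => ?_⟩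
  have := Finset.le_max' (B.filter (· < j)) l (by simp [hl, h.2])
  omega

theorem singleton_mem_parts_iff {s : Finset ℕ} (P : Finpartition s) {i : ℕ} :
    {i} ∈ P.parts ↔ i ∈ s ∧ ∀ y, ¬ IsArc P i y ∧ ¬ IsArc P y i := by
  constructor
  · intro h
    refine ⟨P.le h (mem_singleton_self i), fun y => ⟨?_, ?_⟩⟩
    · rintro ⟨hlt, B, hB, hi, hy, -⟩
      obtain rfl := P.eq_of_mem_parts h hB (mem_singleton_self i) hi
      exact hlt.ne (mem_singleton.1 hy).symm
    · rintro ⟨hlt, B, hB, hy, hi, -⟩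
      obtain rfl := P.eq_of_mem_parts h hB (mem_singleton_self i) hi
      exact hlt.ne (mem_singleton.1 hy)
  · rintro ⟨hi, h⟩
    have hB := P.part_mem.2 hi
    have : P.part i = {i} := by
      refine eq_singleton_iff_unique_mem.2 ⟨P.mem_part hi, fun j hj => ?_⟩
      rcases lt_trichotomy i j with hlt | heq | hlt
      · obtain ⟨l, hl⟩ := exists_isArc_right P hB (P.mem_part hi) hj hlt
        exact absurd hl (h l).1
      · exact heq.symm
      · obtain ⟨l, hl⟩ := exists_isArc_left P hB hj (P.mem_part hi) hlt
        exact absurd hl (h l).2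
    rwa [this] at hB

/-- A partition is determined by its arcs. -/
theorem isArc_injective {s : Finset ℕ} :
    Function.Injective (fun P : Finpartition s => IsArc P) := by
  have key : ∀ P Q : Finpartition s, IsArc P = IsArc Q →
      ∀ d i j, j = i + d → i ∈ P.part j → i ∈ Q.part j := by
    intro P Q h d
    induction d using Nat.strong_induction_on with
    | _ d ih =>
      intro i j hd hi
      have hj : j ∈ s := P.part_nonempty.1 ⟨i, hi⟩
      rcases Nat.eq_zero_or_pos d with rfl | hpos
      · obtain rfl : j = i := hd
        exact Q.mem_part hj
      · by_cases hl : ∃ l ∈ P.part j, i < l ∧ l < j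
        · obtain ⟨l, hl, hil, hlj⟩ := hl
          have hls := P.part_subset j hl
          have e := P.part_eq_of_mem (P.part_mem.2 hj) hl
          have h1 := ih (j - l) (by omega) l j (by omega) hl
          have h2 := ih (l - i) (by omega) i l (by omega) (e ▸ hi)
          rwa [Q.part_eq_of_mem (Q.part_mem.2 hj) h1] at h2
        · push Not at hl
          have : IsArc P i j := (isArc_iff P).2
            ⟨by omega, hi, fun l hl' h => (hl l hl' h.1).not_gt h.2⟩
          rw [h] at this
          exact ((isArc_iff Q).1 this).2.1
  have key' : ∀ P Q : Finpartition s, IsArc P = IsArc Q →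
      ∀ i j, i ∈ P.part j → i ∈ Q.part j := by
    intro P Q h i j hi
    have hj : j ∈ s := P.part_nonempty.1 ⟨i, hi⟩
    have his : i ∈ s := P.part_subset j hi
    rcases le_total i j with hle | hle
    · exact key P Q h (j - i) i j (by omega) hi
    · refine (Q.mem_part_iff_part_eq_part his hj).2
        ((Q.mem_part_iff_part_eq_part hj his).1 (key P Q h (i - j) j i (by omega) ?_)).symm
      exact (P.mem_part_iff_part_eq_part hj his).2
        ((P.mem_part_iff_part_eq_part his hj).1 hi).symm
  intro P Q h
  have hpart : ∀ j, P.part j = Q.part j := fun j =>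
    Finset.ext fun i => ⟨key' P Q h i j, key' Q P h.symm i j⟩
  ext B
  constructor
  · intro hB
    obtain ⟨x, hx, rfl⟩ := P.part_surjOn hB
    rw [hpart]
    exact Q.part_mem.2 hx
  · intro hB
    obtain ⟨x, hx, rfl⟩ := Q.part_surjOn hB
    rw [← hpart]
    exact P.part_mem.2 hx

/-- The equivalence relation whose classes are the chains of a bi-unique relation. -/
def chainSetoid (R : ℕ → ℕ → Prop) (hl : Relator.LeftUnique R) (hr : Relator.RightUnique R) :
    Setoid ℕ where
  r x y := Relation.ReflTransGen R x y ∨ Relation.ReflTransGen R y x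
  iseqv :=
    { refl := fun _ => Or.inl .refl
      symm := Or.symm
      trans := by
        rintro x y z (h1 | h1) (h2 | h2)
        · exact Or.inl (h1.trans h2)
        · have := Relation.ReflTransGen.total_of_right_unique (r := Function.swap R)
            (fun a b c hab hac => hl hab hac)
            (Relation.reflTransGen_swap.2 h1) (Relation.reflTransGen_swap.2 h2)
          simpa only [Relation.reflTransGen_swap, or_comm] using this
        · exact Relation.ReflTransGen.total_of_right_unique hr h1 h2
        · exact Or.inr (h2.trans h1) }

/-- Every bi-unique increasing relation on `s` is the arc relation of a partition of `s`. -/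
theorem exists_isArc_iff {s : Finset ℕ} {R : ℕ → ℕ → Prop} (hlt : ∀ i j, R i j → i < j)
    (hl : Relator.LeftUnique R) (hr : Relator.RightUnique R)
    (hs : ∀ i j, R i j → i ∈ s ∧ j ∈ s) :
    ∃ P : Finpartition s, ∀ i j, IsArc P i j ↔ R i j := by
  classical
  have hle : ∀ {x y}, Relation.ReflTransGen R x y → x ≤ y := by
    intro x y h
    induction h with
    | refl => exact le_rfl
    | tail _ hbc ih => exact ih.trans (hlt _ _ hbc).le
  refine ⟨Finpartition.ofSetSetoid (chainSetoid R hl hr) s, fun i j => ?_⟩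
  have hmem : ∀ a b, b ∈ (Finpartition.ofSetSetoid (chainSetoid R hl hr) s).part a ↔
      a ∈ s ∧ b ∈ s ∧ (Relation.ReflTransGen R a b ∨ Relation.ReflTransGen R b a) :=
    fun a b => Finpartition.mem_part_ofSetSetoid_iff_rel s
  rw [isArc_iff]
  simp only [hmem]
  constructor
  · rintro ⟨hij, ⟨hj, hi, h⟩, hn⟩
    have h : Relation.ReflTransGen R i j :=
      h.resolve_left fun h => (hle h).not_gt hij
    rcases Relation.ReflTransGen.cases_head h with rfl | ⟨l, hil, hlj⟩
    · exact absurd hij (lt_irrefl _)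
    · have := hn l ⟨hj, (hs _ _ hil).2, Or.inr hlj⟩
      have h1 := hlt _ _ hil
      have h2 := hle hlj
      obtain rfl : l = j := by omega
      exact hil
  · intro hR
    have hij := hlt _ _ hR
    refine ⟨hij, ⟨(hs _ _ hR).2, (hs _ _ hR).1, Or.inr (.single hR)⟩, ?_⟩
    rintro l ⟨-, -, h⟩ ⟨hil, hlj⟩
    have hlj' : Relation.ReflTransGen R l j := h.resolve_left fun h => (hle h).not_gt hlj
    rcases Relation.ReflTransGen.cases_tail hlj' with rfl | ⟨m, hlm, hmj⟩
    · exact absurd hlj (lt_irrefl _)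
    · obtain rfl := hl hmj hR
      exact (hle hlm).not_gt hil

/-- `k` related pairs `(i₁,j₁),…,(i_k,j_k)` with `i₁<⋯<i_k≤j₁<⋯<j_k`. -/
def HasTouchingCrossing (R : ℕ → ℕ → Prop) (k : ℕ) : Prop :=
  ∃ f g : Fin k → ℕ,
    StrictMono f ∧ StrictMono g ∧ (∀ m, R (f m) (g m)) ∧ ∀ a b : Fin k, f a ≤ g b

theorem hasEnhancedKCrossing_iff {s : Finset ℕ} (P : Finpartition s) {k : ℕ} (hk : 0 < k) :
    HasEnhancedKCrossing P k ↔ HasTouchingCrossing (IsDiagArc P) k := by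
  constructor
  · rintro (⟨f, g, hf, hg, h, hfg⟩ | ⟨f, g, hf, hg, h, a, b, hab, ha, hb⟩)
    · exact ⟨f, g, hf, hg, h, fun a b => (hfg a b).le⟩
    · exact ⟨f, g, hf, hg, h, fun c d => ((ha c).trans hab.le).trans (hb d)⟩
  · rintro ⟨f, g, hf, hg, h, hfg⟩
    have hlast : ∀ c : Fin k, f c ≤ f ⟨k - 1, by omega⟩ :=
      fun c => hf.monotone (Fin.mk_le_mk.2 (by omega : c.1 ≤ k - 1))
    have hzero : ∀ c : Fin k, g ⟨0, hk⟩ ≤ g c :=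
      fun c => hg.monotone (Fin.mk_le_mk.2 (Nat.zero_le c.1))
    rcases (hfg ⟨k - 1, by omega⟩ ⟨0, hk⟩).lt_or_eq with hlt | heq
    · exact Or.inl ⟨f, g, hf, hg, h, fun a b => ((hlast a).trans_lt hlt).trans_le (hzero b)⟩
    · exact Or.inr ⟨f, g, hf, hg, h, _, _, heq, hlast, hzero⟩

theorem hasKCrossing_iff {s : Finset ℕ} (P : Finpartition s) (k : ℕ) :
    HasKCrossing P k ↔ HasTouchingCrossing (fun i j => IsArc P i (j + 1)) k := by
  constructor
  · rintro ⟨f, g, hf, hg, h, hfg⟩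
    have hpos : ∀ b, 0 < g b := fun b => (Nat.zero_le _).trans_lt (hfg b b)
    refine ⟨f, fun m => g m - 1, hf, fun a b hab => ?_, fun m => ?_, fun a b => ?_⟩
    · have := hg hab
      have := hpos a
      show g a - 1 < g b - 1
      omega
    · show IsArc P (f m) (g m - 1 + 1)
      rw [Nat.sub_add_cancel (hpos m)]
      exact (h m).resolve_right fun h' => (hfg m m).ne h'.1
    · exact Nat.le_sub_one_of_lt (hfg a b)
  · rintro ⟨f, g, hf, hg, h, hfg⟩
    exact ⟨f, fun m => g m + 1, hf, fun a b hab => Nat.succ_lt_succ (hg hab),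
      fun m => Or.inl (h m), fun a b => Nat.lt_succ_of_le (hfg a b)⟩

/-- A bi-unique relation contained in `≤`. -/
structure IsArcSystem (R : ℕ → ℕ → Prop) : Prop where
  le : ∀ i j, R i j → i ≤ j
  left : Relator.LeftUnique R
  right : Relator.RightUnique R

/-- The relation `R` has `x` as an endpoint. -/
def IsEndpoint (R : ℕ → ℕ → Prop) (x : ℕ) : Prop := ∃ y, R x y ∨ R y x

/-- Arc systems whose set of endpoints is exactly `s`, without touching `k`-crossings. -/
def FullSystem (s : Finset ℕ) (k : ℕ) : Type :=
  {R : ℕ → ℕ → Prop // (IsArcSystem R ∧ ∀ x, IsEndpoint R x ↔ x ∈ s) ∧ ¬ HasTouchingCrossing R k}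

/-- Arc systems with endpoints in `s`, without touching `k`-crossings. -/
def PartialSystem (s : Finset ℕ) (k : ℕ) : Type :=
  {R : ℕ → ℕ → Prop // (IsArcSystem R ∧ ∀ x, IsEndpoint R x → x ∈ s) ∧ ¬ HasTouchingCrossing R k}

theorem isArcSystem_isDiagArc {s : Finset ℕ} (P : Finpartition s) :
    IsArcSystem (IsDiagArc P) where
  le := by
    rintro i j (h | h)
    · exact h.1.le
    · exact h.1.le
  left := by
    rintro i j l (h | ⟨rfl, h⟩) (h' | ⟨rfl, h'⟩)
    · exact isArc_leftUnique P h h'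
    · exact absurd h ((singleton_mem_parts_iff P).1 h' |>.2 i).2
    · exact absurd h' ((singleton_mem_parts_iff P).1 h |>.2 j).2
    · rfl
  right := by
    rintro i j l (h | ⟨rfl, h⟩) (h' | ⟨rfl, h'⟩)
    · exact isArc_rightUnique P h h'
    · exact absurd h ((singleton_mem_parts_iff P).1 h' |>.2 j).1
    · exact absurd h' ((singleton_mem_parts_iff P).1 h |>.2 l).1
    · rfl

theorem isEndpoint_isDiagArc {s : Finset ℕ} (P : Finpartition s) (x : ℕ) :
    IsEndpoint (IsDiagArc P) x ↔ x ∈ s := by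
  constructor
  · rintro ⟨y, (h | ⟨rfl, h⟩) | (h | ⟨rfl, h⟩)⟩
    · exact h.left_mem
    · exact P.le h (mem_singleton_self _)
    · exact h.right_mem
    · exact P.le h (mem_singleton_self _)
  · intro hx
    by_cases h : {x} ∈ P.parts
    · exact ⟨x, Or.inl (Or.inr ⟨rfl, h⟩)⟩
    · rw [singleton_mem_parts_iff] at h
      push Not at h
      obtain ⟨y, hy⟩ := h hx
      by_cases hxy : IsArc P x y
      · exact ⟨y, Or.inl (Or.inl hxy)⟩
      · exact ⟨y, Or.inr (Or.inl (hy hxy))⟩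

theorem isDiagArc_injective {s : Finset ℕ} :
    Function.Injective (fun P : Finpartition s => IsDiagArc P) := by
  have key : ∀ (P : Finpartition s) i j, IsArc P i j ↔ IsDiagArc P i j ∧ i ≠ j := by
    refine fun P i j => ⟨fun h => ⟨Or.inl h, h.1.ne⟩, ?_⟩
    rintro ⟨h | h, hne⟩
    · exact h
    · exact absurd h.1 hne
  intro P Q h
  apply isArc_injective
  funext i j
  have h' : IsDiagArc P i j = IsDiagArc Q i j := congrFun (congrFun h i) j
  simp only [key, h']

theorem exists_isDiagArc_eq {s : Finset ℕ} {R : ℕ → ℕ → Prop} (hR : IsArcSystem R)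
    (hs : ∀ x, IsEndpoint R x ↔ x ∈ s) : ∃ P : Finpartition s, IsDiagArc P = R := by
  obtain ⟨P, hP⟩ := exists_isArc_iff (s := s) (R := fun i j => R i j ∧ i ≠ j)
    (fun i j h => (hR.le i j h.1).lt_of_ne h.2) (fun i j l h h' => hR.left h.1 h'.1)
    (fun i j l h h' => hR.right h.1 h'.1)
    (fun i j h => ⟨(hs i).1 ⟨j, Or.inl h.1⟩, (hs j).1 ⟨i, Or.inr h.1⟩⟩)
  refine ⟨P, ?_⟩
  funext i j
  apply propext
  unfold IsDiagArc
  rw [hP, singleton_mem_parts_iff]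
  simp only [hP]
  constructor
  · rintro (h | ⟨rfl, hi, h⟩)
    · exact h.1
    · obtain ⟨y, hy⟩ := (hs i).2 hi
      by_cases hiy : i = y
      · subst hiy
        exact hy.elim id id
      · rcases hy with hy | hy
        · exact absurd ⟨hy, hiy⟩ (h y).1
        · exact absurd ⟨hy, Ne.symm hiy⟩ (h y).2
  · intro h
    by_cases hij : i = j
    · subst hij
      exact Or.inr ⟨rfl, (hs i).1 ⟨i, Or.inl h⟩, fun y =>
        ⟨fun h' => h'.2 (hR.right h h'.1), fun h' => h'.2 (hR.left h'.1 h)⟩⟩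
    · exact Or.inl ⟨h, hij⟩

theorem card_enhanced_noncrossing (s : Finset ℕ) {k : ℕ} (hk : 0 < k) :
    Nat.card {P : Finpartition s // ¬ HasEnhancedKCrossing P k} =
      Nat.card (FullSystem s k) := by
  refine Nat.card_congr (Equiv.ofBijective
    (fun P => ⟨IsDiagArc P.1, ⟨isArcSystem_isDiagArc P.1, isEndpoint_isDiagArc P.1⟩,
      fun h => P.2 ((hasEnhancedKCrossing_iff P.1 hk).2 h)⟩) ⟨fun P Q h => ?_, ?_⟩)
  · exact Subtype.ext (isDiagArc_injective (congrArg Subtype.val h))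
  · rintro ⟨R, ⟨hR, hs⟩, hc⟩
    obtain ⟨P, rfl⟩ := exists_isDiagArc_eq hR hs
    exact ⟨⟨P, fun h => hc ((hasEnhancedKCrossing_iff P hk).1 h)⟩, rfl⟩

theorem card_noncrossing (n k : ℕ) :
    Nat.card {P : Finpartition (Finset.Icc 1 (n + 1)) // ¬ HasKCrossing P k} =
      Nat.card (PartialSystem (Finset.Icc 1 n) k) := by
  refine Nat.card_congr (Equiv.ofBijective
    (fun P => ⟨fun i j => IsArc P.1 i (j + 1), ⟨⟨fun i j h => Nat.le_of_lt_succ h.1,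
      fun i j l h h' => isArc_leftUnique P.1 h h',
      fun i j l h h' => Nat.succ_injective (isArc_rightUnique P.1 h h')⟩, ?_⟩,
      fun h => P.2 ((hasKCrossing_iff P.1 k).2 h)⟩) ⟨fun P Q h => ?_, ?_⟩)
  · rintro x ⟨y, h | h⟩ <;>
    · have h1 := h.1
      have h2 := mem_Icc.1 h.left_mem
      have h3 := mem_Icc.1 h.right_mem
      exact mem_Icc.2 ⟨by omega, by omega⟩
  · apply Subtype.ext
    apply isArc_injective
    have h' := congrArg Subtype.val h
    funext i j
    rcases j with _ | j
    · exact propext ⟨fun h => absurd h.1 (Nat.not_lt_zero _),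
        fun h => absurd h.1 (Nat.not_lt_zero _)⟩
    · exact congrFun (congrFun h' i) j
  · rintro ⟨R, ⟨hR, hs⟩, hc⟩
    obtain ⟨P, hP⟩ := exists_isArc_iff (s := Finset.Icc 1 (n + 1))
      (R := fun i j => 1 ≤ j ∧ R i (j - 1))
      (fun i j h => by have := hR.le _ _ h.2; have := h.1; omega)
      (fun i j l h h' => hR.left h.2 h'.2)
      (fun i j l h h' => by have := hR.right h.2 h'.2; have := h.1; have := h'.1; omega)
      (fun i j h => by
        have h1 := mem_Icc.1 (hs i ⟨_, Or.inl h.2⟩)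
        have h2 := mem_Icc.1 (hs _ ⟨_, Or.inr h.2⟩)
        have := h.1
        exact ⟨mem_Icc.2 (by omega), mem_Icc.2 (by omega)⟩)
    have hPR : (fun i j => IsArc P i (j + 1)) = R := by
      funext i j
      exact propext ((hP i (j + 1)).trans ⟨fun h => h.2, fun h => ⟨Nat.succ_pos j, h⟩⟩)
    refine ⟨⟨P, fun h => hc ?_⟩, Subtype.ext hPR⟩
    rw [← hPR]
    exact (hasKCrossing_iff P k).1 h

/-- Transport of a relation along an order isomorphism of finsets. -/
def pullRel {s t : Finset ℕ} (e : t ≃o s) (R : ℕ → ℕ → Prop) (x y : ℕ) : Prop :=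
  ∃ (hx : x ∈ t) (hy : y ∈ t), R (e ⟨x, hx⟩) (e ⟨y, hy⟩)

theorem pullRel_symm_pullRel {s t : Finset ℕ} (e : t ≃o s) {R : ℕ → ℕ → Prop}
    (hs : ∀ x, IsEndpoint R x ↔ x ∈ s) : pullRel e.symm (pullRel e R) = R := by
  funext x y
  apply propext
  constructor
  · rintro ⟨hx, hy, hx', hy', h⟩
    simpa using h
  · intro h
    exact ⟨(hs x).1 ⟨y, Or.inl h⟩, (hs y).1 ⟨x, Or.inr h⟩, Subtype.coe_prop _,
      Subtype.coe_prop _, by simpa using h⟩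

/-- Transport of full systems along an order isomorphism. -/
def FullSystem.pull {s t : Finset ℕ} {k : ℕ} (e : t ≃o s) (R : FullSystem s k) :
    FullSystem t k := by
  refine ⟨pullRel e R.1, ?_⟩
  obtain ⟨R, ⟨hR, hs⟩, hc⟩ := R
  refine ⟨⟨⟨?_, ?_, ?_⟩, ?_⟩, ?_⟩
  · rintro i j ⟨hi, hj, h⟩
    simpa using hR.le _ _ h
  · rintro i j l ⟨hi, hl, h⟩ ⟨hj, hl', h'⟩
    simpa using e.injective (Subtype.ext (hR.left h h'))
  · rintro i j l ⟨hi, hj, h⟩ ⟨hi', hl, h'⟩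
    simpa using e.injective (Subtype.ext (hR.right h h'))
  · intro x
    constructor
    · rintro ⟨y, ⟨hx, hy, h⟩ | ⟨hy, hx, h⟩⟩ <;> exact hx
    · intro hx
      obtain ⟨y, hy⟩ := (hs (e ⟨x, hx⟩)).2 (Subtype.coe_prop _)
      have hys : y ∈ s := (hs y).1 ⟨_, hy.symm⟩
      refine ⟨e.symm ⟨y, hys⟩, hy.imp (fun h => ?_) (fun h => ?_)⟩
      · exact ⟨hx, Subtype.coe_prop _, by simpa using h⟩
      · exact ⟨Subtype.coe_prop _, hx, by simpa using h⟩
  · rintro ⟨f, g, hf, hg, h, hfg⟩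
    choose hft hgt h using h
    exact hc ⟨fun m => e ⟨f m, hft m⟩, fun m => e ⟨g m, hgt m⟩,
      fun a b hab => e.strictMono (Subtype.mk_lt_mk.2 (hf hab)),
      fun a b hab => e.strictMono (Subtype.mk_lt_mk.2 (hg hab)), h,
      fun a b => e.monotone (Subtype.mk_le_mk.2 (hfg a b))⟩

theorem card_fullSystem_congr {s t : Finset ℕ} (h : #s = #t) (k : ℕ) :
    Nat.card (FullSystem s k) = Nat.card (FullSystem t k) := by
  let e : t ≃o s := (t.orderIsoOfFin h.symm).symm.trans (s.orderIsoOfFin rfl)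
  exact Nat.card_congr
    { toFun := FullSystem.pull e
      invFun := FullSystem.pull e.symm
      left_inv := fun R => Subtype.ext (pullRel_symm_pullRel e R.2.1.2)
      right_inv := fun R => Subtype.ext (pullRel_symm_pullRel e.symm R.2.1.2) }

theorem finite_fullSystem (s : Finset ℕ) (k : ℕ) : Finite (FullSystem s k) := by
  refine Finite.of_surjective
    (fun P : {P : Finpartition s // ¬ HasTouchingCrossing (IsDiagArc P) k} =>
      (⟨IsDiagArc P.1, ⟨isArcSystem_isDiagArc P.1, isEndpoint_isDiagArc P.1⟩, P.2⟩ :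
        FullSystem s k)) ?_
  rintro ⟨R, ⟨hR, hs⟩, hc⟩
  obtain ⟨P, rfl⟩ := exists_isDiagArc_eq hR hs
  exact ⟨⟨P, hc⟩, rfl⟩

/-- A partial system is a full system on its set of endpoints. -/
theorem card_partialSystem (s : Finset ℕ) (k : ℕ) :
    Nat.card (PartialSystem s k) = ∑ u ∈ s.powerset, Nat.card (FullSystem u k) := by
  classical
  have := finite_fullSystem
  rw [← Finset.sum_coe_sort, ← Nat.card_sigma]
  refine Nat.card_congr (Equiv.ofBijective
    (fun R => ⟨⟨s.filter (IsEndpoint R.1), mem_powerset.2 (filter_subset _ _)⟩,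
      ⟨R.1, ⟨R.2.1.1, fun x => ?_⟩, R.2.2⟩⟩) ⟨fun R S h => ?_, ?_⟩)
  · rw [mem_filter]
    exact ⟨fun h => ⟨R.2.1.2 x h, h⟩, fun h => h.2⟩
  · exact Subtype.ext (congrArg (fun p : Σ u : s.powerset, FullSystem u k => p.2.1) h)
  · rintro ⟨⟨u, hu⟩, ⟨R, ⟨hR, hs⟩, hc⟩⟩
    have hus := mem_powerset.1 hu
    refine ⟨⟨R, ⟨hR, fun x h => hus ((hs x).1 h)⟩, hc⟩, ?_⟩
    have : u = s.filter (IsEndpoint R) := by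
      ext x
      rw [mem_filter, hs]
      exact ⟨fun h => ⟨hus h, h⟩, fun h => h.2⟩
    subst this
    rfl

/-- For `n ≥ 1`, `k ≥ 2`, the number of `k`-noncrossing partitions of
`{1,…,n+1}` equals `∑_{i=0}^n C(n,i) ⬝ #(enhanced k-noncrossing partitions of {1,…,i})`. -/
theorem stmt1 (n k : ℕ) (hn : 1 ≤ n) (hk : 2 ≤ k) :
    Nat.card {P : Finpartition (Finset.Icc 1 (n + 1)) // ¬ HasKCrossing P k} =
      ∑ i ∈ Finset.range (n + 1),
        n.choose i *
          Nat.card {P : Finpartition (Finset.Icc 1 i) // ¬ HasEnhancedKCrossing P k} := by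
  rw [card_noncrossing, card_partialSystem]
  have h : ∀ u ∈ (Finset.Icc 1 n).powerset, Nat.card (FullSystem u k) =
      Nat.card (FullSystem (Finset.Icc 1 #u) k) :=
    fun u _ => card_fullSystem_congr (by simp) k
  rw [Finset.sum_congr rfl h,
    Finset.sum_powerset_apply_card (fun i => Nat.card (FullSystem (Finset.Icc 1 i) k))]
  simp only [Nat.card_Icc, Nat.add_sub_cancel, smul_eq_mul,
    card_enhanced_noncrossing _ (zero_lt_two.trans_le hk)]
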